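/- arXiv:math/0102206 — 4 statements merged into one kernel-verified Lean document; each statement's English description precedes it below -/
import Mathlib

section
/- Let d ≥ 1 and let ᾱ = (α_1,...,α_d) ∈ ℝ^d be badly approximable with constant β > 0. Then for every positive integer k, the discrepancy of the k-th convolution power of Q satisfies D(Q^{*k}) ≤ 19.857 · (d√d/β)^d · k^{−d/2}. -/
open MeasureTheory Real
open scoped ENNReal

noncomputable section

/-- The generating measure `Q` on the circle `ℝ/ℤ` of the random walk generated by the
`d`-tuple `α`: mass `1/(2d)` at each point `α j mod 1` and `-α j mod 1`. -/
def circleQ {d : ℕ} (α : Fin d → ℝ) : Measure (AddCircle (1 : ℝ)) :=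
  ((2 * d : ℝ≥0∞))⁻¹ •
    ∑ j : Fin d, (Measure.dirac ((α j : ℝ) : AddCircle (1 : ℝ)) +
      Measure.dirac (((-(α j) : ℝ)) : AddCircle (1 : ℝ)))

/-- `k`-fold convolution power of a measure on the circle. -/
def convPow (μ : Measure (AddCircle (1 : ℝ))) : ℕ → Measure (AddCircle (1 : ℝ))
  | 0 => Measure.dirac 0
  | k + 1 => (convPow μ k).conv μ

/-- The discrepancy of a measure `P` on the circle: the supremum over all arcs
(connected subsets) `I` of `|P(I) - λ(I)|`, where `λ` is Haar (Lebesgue) probability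
measure (`volume` on `AddCircle 1`). -/
def discrepancy (P : Measure (AddCircle (1 : ℝ))) : ℝ :=
  sSup { r : ℝ | ∃ I : Set (AddCircle (1 : ℝ)), IsConnected I ∧
    r = |(P I).toReal - (volume I).toReal| }

/-- The `m`-th Fourier coefficient of a measure on the circle: `∫ e^{-2πimx} dP(x)`. -/
def fourierCoeffMeasure (P : Measure (AddCircle (1 : ℝ))) (m : ℤ) : ℂ :=
  ∫ x, fourier (-m) x ∂P

/-- Euclidean distance from `x ∈ ℝ^d` to the nearest integer lattice point. -/
def latticeDist {d : ℕ} (x : Fin d → ℝ) : ℝ :=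
  ⨅ v : Fin d → ℤ, Real.sqrt (∑ i, (x i - v i) ^ 2)

lemma hasSum_cos_div_sq {u : ℝ} (hu : |u| ≤ 1) :
    HasSum (fun n : ℕ => 1 / (n : ℝ) ^ 2 * cos (2 * π * n * u))
      (π ^ 2 * (u ^ 2 - |u| + 1 / 6)) := by
  have h := hasSum_one_div_nat_pow_mul_cos (k := 1) one_ne_zero
    (x := |u|) ⟨abs_nonneg u, hu⟩
  convert! h using 1
  · funext n
    rw [← cos_abs (2 * π * n * u), abs_mul, abs_of_nonneg (by positivity : (0 : ℝ) ≤ 2 * π * n)]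
  · have hb : bernoulli 2 = 1 / 6 := by
      rw [bernoulli_eq_bernoulli'_of_ne_one (by norm_num), bernoulli'_two]
    simp [Polynomial.bernoulli, Finset.sum_range_succ, hb]
    ring_nf

/-- The coefficients of the trapezoid with plateau of length `L` and ramps of length `ε`. -/
def trapCoeff (L ε : ℝ) (n : ℕ) : ℝ :=
  2 / (π ^ 2 * ε * (n : ℝ) ^ 2) * (sin (π * n * (L + ε)) * sin (π * n * ε))

lemma hasSum_trapezoid {L ε t : ℝ} (hε : 0 < ε) (hL : 0 ≤ L) (hLε : L + 2 * ε ≤ 1)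
    (ht0 : 0 ≤ t) (ht1 : t ≤ 1) :
    HasSum (fun n : ℕ => trapCoeff L ε n * cos (2 * π * n * (t - (ε + L / 2))))
      ((|t| - |t - ε| - |t - ε - L| + |t - 2 * ε - L|) / (2 * ε) - (L + ε)) := by
  have h1 := hasSum_cos_div_sq (u := t) (by rw [abs_le]; constructor <;> linarith)
  have h2 := hasSum_cos_div_sq (u := t - ε) (by rw [abs_le]; constructor <;> linarith)
  have h3 := hasSum_cos_div_sq (u := t - ε - L) (by rw [abs_le]; constructor <;> linarith)
  have h4 := hasSum_cos_div_sq (u := t - 2 * ε - L) (by rw [abs_le]; constructor <;> linarith)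
  have h := (((h1.sub h2).sub h3).add h4).mul_left (-1 / (2 * π ^ 2 * ε))
  convert! h using 1
  · funext n
    have e1 : 2 * π * n * t = 2 * π * n * (t - (ε + L / 2)) + (π * n * (L + ε) + π * n * ε) := by
      ring
    have e2 : 2 * π * n * (t - ε) =
        2 * π * n * (t - (ε + L / 2)) + (π * n * (L + ε) - π * n * ε) := by ring
    have e3 : 2 * π * n * (t - ε - L) =
        2 * π * n * (t - (ε + L / 2)) - (π * n * (L + ε) - π * n * ε) := by ring
    have e4 : 2 * π * n * (t - 2 * ε - L) =
        2 * π * n * (t - (ε + L / 2)) - (π * n * (L + ε) + π * n * ε) := by ring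
    rw [e1, e2, e3, e4, trapCoeff]
    generalize 2 * π * n * (t - (ε + L / 2)) = x
    generalize π * n * (L + ε) = y
    generalize π * n * ε = z
    simp only [cos_add, cos_sub, sin_add, sin_sub]
    rcases eq_or_ne (n : ℝ) 0 with hn | hn
    · simp [hn]
    · field_simp
      ring
  · field_simp
    ring

lemma trapezoid_nonneg {L ε t : ℝ} (hε : 0 < ε) (hL : 0 ≤ L) (ht0 : 0 ≤ t) :
    0 ≤ (|t| - |t - ε| - |t - ε - L| + |t - 2 * ε - L|) / (2 * ε) := by
  apply div_nonneg _ (by positivity)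
  rw [abs_of_nonneg ht0]
  rcases abs_cases (t - ε) with h | h <;> rcases abs_cases (t - ε - L) with h' | h' <;>
    rcases abs_cases (t - 2 * ε - L) with h'' | h'' <;> linarith

lemma trapezoid_eq_one {L ε t : ℝ} (hε : 0 < ε) (ht0 : ε ≤ t) (ht1 : t ≤ ε + L) :
    (|t| - |t - ε| - |t - ε - L| + |t - 2 * ε - L|) / (2 * ε) = 1 := by
  rw [abs_of_nonneg (by linarith : 0 ≤ t), abs_of_nonneg (by linarith : 0 ≤ t - ε),
    abs_of_nonpos (by linarith : t - ε - L ≤ 0), abs_of_nonpos (by linarith : t - 2 * ε - L ≤ 0)]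
  field_simp
  ring

/-- The weight of the `n`-th Fourier coefficient in the discrepancy bound. -/
def smoothWeight (ε : ℝ) (n : ℕ) : ℝ := min (1 / (3 * (n : ℝ))) (1 / (9 * ε * (n : ℝ) ^ 2))

lemma smoothWeight_nonneg {ε : ℝ} (hε : 0 < ε) (n : ℕ) : 0 ≤ smoothWeight ε n := by
  unfold smoothWeight
  positivity

lemma abs_trapCoeff_le {L ε : ℝ} (hε : 0 < ε) (n : ℕ) :
    |trapCoeff L ε n| ≤ 2 * smoothWeight ε n := by
  have hπ := pi_gt_three
  rcases Nat.eq_zero_or_pos n with rfl | hn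
  · simp [trapCoeff, smoothWeight]
  have hn' : (0 : ℝ) < n := by exact_mod_cast hn
  have h1 : |sin (π * n * (L + ε)) * sin (π * n * ε)| ≤ π * n * ε := by
    rw [abs_mul]
    calc _ ≤ 1 * |π * n * ε| := by
          refine mul_le_mul ?_ ?_ (abs_nonneg _) zero_le_one
          exacts [abs_sin_le_one _, abs_sin_le_abs]
      _ = _ := by rw [one_mul, abs_of_pos (by positivity)]
  have h2 : |sin (π * n * (L + ε)) * sin (π * n * ε)| ≤ 1 := by
    rw [abs_mul]
    exact mul_le_one₀ (abs_sin_le_one _) (abs_nonneg _) (abs_sin_le_one _)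
  rw [trapCoeff, abs_mul, abs_of_pos (by positivity), smoothWeight, mul_min_of_nonneg _ _ zero_le_two]
  apply le_min
  · calc _ ≤ 2 / (π ^ 2 * ε * (n : ℝ) ^ 2) * (π * n * ε) := by gcongr
      _ = 2 * (1 / (π * n)) := by field_simp
      _ ≤ _ := by gcongr
  · calc _ ≤ 2 / (π ^ 2 * ε * (n : ℝ) ^ 2) * 1 := by gcongr
      _ = 2 * (1 / (π ^ 2 * ε * (n : ℝ) ^ 2)) := by ring
      _ ≤ _ := by
        gcongr
        nlinarith

lemma summable_smoothWeight {ε : ℝ} (hε : 0 < ε) : Summable (smoothWeight ε) := by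
  refine Summable.of_nonneg_of_le (smoothWeight_nonneg hε) (fun n => min_le_right _ _) ?_
  have h := (Real.summable_one_div_nat_pow.mpr (one_lt_two)).mul_left (1 / (9 * ε))
  refine h.congr fun n => ?_
  rw [one_div_mul_one_div]

lemma norm_integral_fourier_sub_le (P : Measure (AddCircle (1 : ℝ))) (n : ℤ)
    (c : AddCircle (1 : ℝ)) :
    ‖∫ x, (fourier n (x - c) : ℂ) ∂P‖ = ‖∫ x, (fourier n x : ℂ) ∂P‖ := by
  have h : ∀ x : AddCircle (1 : ℝ), (fourier n (x - c) : ℂ) = fourier n x * fourier n (-c) := by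
    intro x
    simp [sub_eq_add_neg, fourier_apply, smul_add, AddCircle.toCircle_add]
  simp_rw [h]
  rw [integral_mul_const, norm_mul, fourier_apply (x := -c), Circle.norm_coe, mul_one]

lemma measureReal_arc_le (P : Measure (AddCircle (1 : ℝ))) [IsProbabilityMeasure P]
    {ε a b S : ℝ} (hε : 0 < ε) (hab : a ≤ b)
    (hS : ∀ M : ℕ, ∑ n ∈ Finset.range M,
      smoothWeight ε n * ‖∫ x, (fourier (n : ℤ) x : ℂ) ∂P‖ ≤ S) :
    P.real ((fun x : ℝ => (x : AddCircle (1 : ℝ))) '' Set.Icc a b) ≤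
      (b - a) + 2 * ε + 2 * S := by
  have hS0 : 0 ≤ S := by simpa using hS 0
  by_cases hLε : (b - a) + 2 * ε ≤ 1
  swap
  · have : P.real ((fun x : ℝ => (x : AddCircle (1 : ℝ))) '' Set.Icc a b) ≤ 1 := measureReal_le_one
    linarith
  set L := b - a with hLdef
  have hL : 0 ≤ L := by linarith
  set I := (fun x : ℝ => (x : AddCircle (1 : ℝ))) '' Set.Icc a b with hI
  have hImeas : MeasurableSet I :=
    (isCompact_Icc.image (AddCircle.continuous_mk' 1)).isClosed.measurableSet
  set c : AddCircle (1 : ℝ) := ((a + L / 2 : ℝ) : AddCircle (1 : ℝ)) with hc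
  set F : ℕ → AddCircle (1 : ℝ) → ℝ :=
    fun n x => trapCoeff L ε n * (fourier (n : ℤ) (x - c) : ℂ).re with hF
  have hFcont : ∀ n, Continuous (F n) := by
    intro n
    simp only [hF]
    fun_prop
  have hFbound : ∀ n x, ‖F n x‖ ≤ 2 * smoothWeight ε n := by
    intro n x
    simp only [hF, norm_mul, Real.norm_eq_abs]
    calc _ ≤ |trapCoeff L ε n| * 1 := by
          gcongr
          refine (Complex.abs_re_le_norm _).trans ?_
          rw [fourier_apply]
          exact (Circle.norm_coe _).le
      _ ≤ _ := by rw [mul_one]; exact abs_trapCoeff_le hε n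
  have hw : Summable (fun n => 2 * smoothWeight ε n) := (summable_smoothWeight hε).mul_left 2
  have hint : ∀ f : AddCircle (1 : ℝ) → ℝ, Continuous f → Integrable f P := fun f hf =>
    hf.integrable_of_hasCompactSupport (HasCompactSupport.of_compactSpace f)
  have hpt : ∀ x, I.indicator (fun _ => (1 : ℝ)) x ≤ (L + ε) + ∑' n, F n x := by
    intro x
    obtain ⟨y, hy, rfl⟩ : x ∈ (fun x : ℝ => (x : AddCircle (1 : ℝ))) ''
        Set.Ico (a - ε) (a - ε + 1) := by
      rw [show (fun x : ℝ => (x : AddCircle (1 : ℝ))) '' Set.Ico (a - ε) (a - ε + 1) = Set.univ from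
        AddCircle.coe_image_Ico_eq 1 (a - ε)]
      trivial
    obtain ⟨hy0, hy1⟩ := hy
    have h := hasSum_trapezoid (t := y - a + ε) hε hL hLε (by linarith) (by linarith)
    have hterm : (fun n => F n (y : AddCircle (1 : ℝ))) = fun n : ℕ =>
        trapCoeff L ε n * cos (2 * π * n * (y - a + ε - (ε + L / 2))) := by
      funext n
      simp only [hF, hc]
      rw [← AddCircle.coe_sub, fourier_coe_apply]
      congr 1
      rw [show (2 * (π : ℂ) * Complex.I * ((n : ℤ) : ℂ) * ((y - (a + L / 2) : ℝ) : ℂ) /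
        ((1 : ℝ) : ℂ)) = ((2 * π * n * (y - a + ε - (ε + L / 2)) : ℝ) : ℂ) * Complex.I by
          push_cast; ring]
      exact Complex.exp_ofReal_mul_I_re _
    have hsum : ∑' n, F n (y : AddCircle (1 : ℝ)) = (|y - a + ε| - |y - a + ε - ε| -
        |y - a + ε - ε - L| + |y - a + ε - 2 * ε - L|) / (2 * ε) - (L + ε) := by
      rw [hterm]; exact h.tsum_eq
    simp only at hsum ⊢
    rw [hsum]
    by_cases hyI : (y : AddCircle (1 : ℝ)) ∈ I
    · rw [Set.indicator_of_mem hyI]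
      obtain ⟨z, hz, hzy⟩ := hyI
      have : z = y := by
        refine (AddCircle.coe_eq_coe_iff_of_mem_Ico (p := 1) (a := a - ε) ?_ ?_).mp hzy
        · constructor <;> linarith [hz.1, hz.2]
        · exact ⟨hy0, hy1⟩
      subst this
      rw [trapezoid_eq_one hε (by linarith [hz.1]) (by linarith [hz.2])]
      linarith
    · rw [Set.indicator_of_notMem hyI]
      have := trapezoid_nonneg (t := y - a + ε) hε hL (by linarith)
      linarith
  have hcont : Continuous fun x => ∑' n, F n x := continuous_tsum hFcont hw hFbound
  have hs := hasSum_integral_of_summable_integral_norm (μ := P) (fun n => hint _ (hFcont n))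
    (Summable.of_nonneg_of_le (fun n => integral_nonneg fun _ => norm_nonneg _)
      (fun n => by
        have := integral_mono (μ := P) (hint _ (hFcont n)).norm (integrable_const _) (hFbound n)
        simpa using this) hw)
  have hterm : ∀ n, ∫ x, F n x ∂P ≤ 2 * (smoothWeight ε n * ‖∫ x, (fourier (n : ℤ) x : ℂ) ∂P‖) := by
    intro n
    have h1 : ∫ x, F n x ∂P = trapCoeff L ε n * (∫ x, (fourier (n : ℤ) (x - c) : ℂ) ∂P).re := by
      simp only [hF]
      rw [integral_const_mul]
      congr 1
      refine integral_re (𝕜 := ℂ) ?_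
      exact Continuous.integrable_of_hasCompactSupport (by fun_prop)
        (HasCompactSupport.of_compactSpace _)
    rw [h1]
    calc _ ≤ |trapCoeff L ε n * (∫ x, (fourier (n : ℤ) (x - c) : ℂ) ∂P).re| := le_abs_self _
      _ ≤ |trapCoeff L ε n| * ‖∫ x, (fourier (n : ℤ) (x - c) : ℂ) ∂P‖ := by
        rw [abs_mul]
        gcongr
        exact Complex.abs_re_le_norm _
      _ ≤ 2 * smoothWeight ε n * ‖∫ x, (fourier (n : ℤ) x : ℂ) ∂P‖ := by
        rw [norm_integral_fourier_sub_le]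
        gcongr
        exact abs_trapCoeff_le hε n
      _ = _ := by ring
  have htsum : ∫ x, ∑' n, F n x ∂P ≤ 2 * S := by
    refine le_of_tendsto hs.tendsto_sum_nat (Filter.Eventually.of_forall fun M => ?_)
    calc _ ≤ ∑ n ∈ Finset.range M,
          2 * (smoothWeight ε n * ‖∫ x, (fourier (n : ℤ) x : ℂ) ∂P‖) :=
          Finset.sum_le_sum fun n _ => hterm n
      _ ≤ 2 * S := by rw [← Finset.mul_sum]; linarith [hS M]
  calc P.real I = ∫ x, I.indicator (fun _ => (1 : ℝ)) x ∂P := by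
        rw [integral_indicator_const _ hImeas]; simp
    _ ≤ ∫ x, ((L + ε) + ∑' n, F n x) ∂P :=
        integral_mono ((integrable_const _).indicator hImeas)
          ((integrable_const _).add (hint _ hcont)) hpt
    _ = (L + ε) + ∫ x, ∑' n, F n x ∂P := by
        rw [integral_add (integrable_const _) (hint _ hcont)]; simp
    _ ≤ _ := by linarith

lemma exists_arc_between {I : Set (AddCircle (1 : ℝ))} (hI : IsConnected I) (hne : I ≠ Set.univ) :
    ∃ a b : ℝ, a ≤ b ∧ b ≤ a + 1 ∧
      (fun x : ℝ => (x : AddCircle (1 : ℝ))) '' Set.Ioo a b ⊆ I ∧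
      I ⊆ (fun x : ℝ => (x : AddCircle (1 : ℝ))) '' Set.Icc a b := by
  obtain ⟨q, hq⟩ := (Set.ne_univ_iff_exists_notMem I).mp hne
  obtain ⟨p, rfl⟩ := QuotientAddGroup.mk_surjective q
  set e := AddCircle.openPartialHomeomorphCoe (1 : ℝ) p
  have hsub : I ⊆ e.target := by
    intro x hx
    simp only [e, AddCircle.openPartialHomeomorphCoe_target, Set.mem_compl_iff,
      Set.mem_singleton_iff]
    rintro rfl
    exact hq hx
  set J := e.symm '' I
  have hJ : IsConnected J := hI.image _ (e.continuousOn_symm.mono hsub)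
  have hJsub : J ⊆ Set.Ioo p (p + 1) := by
    rintro _ ⟨x, hx, rfl⟩
    exact e.map_target (hsub hx)
  have hIJ : I = (fun x : ℝ => (x : AddCircle (1 : ℝ))) '' J := by
    ext x
    constructor
    · intro hx
      exact ⟨e.symm x, ⟨x, hx, rfl⟩, e.right_inv (hsub hx)⟩
    · rintro ⟨_, ⟨y, hy, rfl⟩, rfl⟩
      have := e.right_inv (hsub hy)
      change e (e.symm y) ∈ I
      rwa [this]
  have hbb : BddBelow J := ⟨p, fun x hx => (hJsub hx).1.le⟩
  have hba : BddAbove J := ⟨p + 1, fun x hx => (hJsub hx).2.le⟩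
  have h1 : p ≤ sInf J := le_csInf hJ.nonempty fun x hx => (hJsub hx).1.le
  have h2 : sSup J ≤ p + 1 := csSup_le hJ.nonempty fun x hx => (hJsub hx).2.le
  refine ⟨sInf J, sSup J, csInf_le_csSup hJ.nonempty hbb hba, by linarith, ?_, ?_⟩
  · rw [hIJ]
    exact Set.image_mono (hJ.Ioo_csInf_csSup_subset hbb hba)
  · rw [hIJ]
    exact Set.image_mono (subset_Icc_csInf_csSup hbb hba)

lemma isOpen_coe_image_Ioo (a b : ℝ) :
    IsOpen ((fun x : ℝ => (x : AddCircle (1 : ℝ))) '' Set.Ioo a b) :=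
  QuotientAddGroup.isOpenMap_coe _ isOpen_Ioo

lemma le_volumeReal_coe_image_Ioo {a b : ℝ} (hba : b ≤ a + 1) :
    b - a ≤ volume.real ((fun x : ℝ => (x : AddCircle (1 : ℝ))) '' Set.Ioo a b) := by
  have h : volume.real (Set.Ioo a b) ≤
      volume.real ((fun x : ℝ => (x : AddCircle (1 : ℝ))) '' Set.Ioo a b) := by
    rw [measureReal_def, measureReal_def]
    refine ENNReal.toReal_mono (measure_ne_top _ _) ?_
    rw [AddCircle.add_projection_respects_measure 1 a (isOpen_coe_image_Ioo a b).measurableSet]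
    refine measure_mono fun x hx => ⟨⟨x, hx, rfl⟩, hx.1, hx.2.le.trans hba⟩
  refine le_trans ?_ h
  rw [Real.volume_real_Ioo]
  exact le_max_left _ _

lemma coe_image_Ioo_union_Icc {a b : ℝ} :
    (fun x : ℝ => (x : AddCircle (1 : ℝ))) '' Set.Ioo a b ∪
      (fun x : ℝ => (x : AddCircle (1 : ℝ))) '' Set.Icc b (a + 1) = Set.univ := by
  rw [← Set.image_union, ← Set.univ_subset_iff, ← AddCircle.coe_image_Ioc_eq (1 : ℝ) a]
  refine Set.image_mono fun x hx => ?_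
  rcases lt_or_ge x b with h | h
  · exact Or.inl ⟨hx.1, h⟩
  · exact Or.inr ⟨h, hx.2⟩

lemma volumeReal_coe_image_Icc_le {a b : ℝ} (hab : a ≤ b) :
    volume.real ((fun x : ℝ => (x : AddCircle (1 : ℝ))) '' Set.Icc a b) ≤ b - a := by
  set U := (fun x : ℝ => (x : AddCircle (1 : ℝ))) '' Set.Ioo b (a + 1)
  have hvol : volume.real (Set.univ : Set (AddCircle (1 : ℝ))) = 1 := by
    simp [measureReal_def]
  by_cases h1 : a + 1 < b
  · have : volume.real ((fun x : ℝ => (x : AddCircle (1 : ℝ))) '' Set.Icc a b) ≤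
        volume.real (Set.univ : Set (AddCircle (1 : ℝ))) := measureReal_mono (Set.subset_univ _)
    linarith
  have hsub : (fun x : ℝ => (x : AddCircle (1 : ℝ))) '' Set.Icc a b ⊆ Uᶜ := by
    rintro _ ⟨x, hx, rfl⟩ ⟨y, hy, hxy⟩
    have hx' : x ∈ Set.Ico a (a + 1) ∨ x = a + 1 := by
      rcases lt_or_eq_of_le (hx.2.trans (not_lt.mp h1)) with h | h
      · exact Or.inl ⟨hx.1, h⟩
      · exact Or.inr h
    have hy' : y ∈ Set.Ico a (a + 1) := ⟨hab.trans hy.1.le, hy.2⟩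
    rcases hx' with hx' | rfl
    · have := (AddCircle.coe_eq_coe_iff_of_mem_Ico hy' hx').mp hxy
      linarith [hy.1, hx.2]
    · have := hx.2
      linarith [hy.1, hy.2]
  have h2 : volume.real U + volume.real Uᶜ = 1 := by
    rw [measureReal_add_measureReal_compl (isOpen_coe_image_Ioo _ _).measurableSet, hvol]
  have h3 : (a + 1) - b ≤ volume.real U := le_volumeReal_coe_image_Ioo (by linarith)
  have h4 := measureReal_mono (μ := volume) hsub
  linarith

lemma discrepancy_le_of_arcs (P : Measure (AddCircle (1 : ℝ))) [IsProbabilityMeasure P] {C : ℝ}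
    (hC : 0 ≤ C) (h : ∀ a b : ℝ, a ≤ b →
      P.real ((fun x : ℝ => (x : AddCircle (1 : ℝ))) '' Set.Icc a b) ≤ (b - a) + C) :
    discrepancy P ≤ C := by
  refine Real.sSup_le ?_ hC
  rintro r ⟨I, hI, rfl⟩
  by_cases hu : I = Set.univ
  · subst hu
    simpa using hC
  obtain ⟨a, b, hab, hba, h1, h2⟩ := exists_arc_between hI hu
  have v1 := (le_volumeReal_coe_image_Ioo hba).trans (measureReal_mono (μ := volume) h1)
  have v2 := (measureReal_mono (μ := volume) h2).trans (volumeReal_coe_image_Icc_le hab)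
  have p1 := (measureReal_mono (μ := P) h2).trans (h a b hab)
  have p2 := measureReal_mono (μ := P) h1
  have p3 := h b (a + 1) hba
  have p4 := measureReal_union_le (μ := P) ((fun x : ℝ => (x : AddCircle (1 : ℝ))) '' Set.Ioo a b)
    ((fun x : ℝ => (x : AddCircle (1 : ℝ))) '' Set.Icc b (a + 1))
  rw [coe_image_Ioo_union_Icc, probReal_univ] at p4
  rw [← measureReal_def, ← measureReal_def, abs_le]
  constructor <;> linarith

lemma discrepancy_le_one (P : Measure (AddCircle (1 : ℝ))) [IsProbabilityMeasure P] :
    discrepancy P ≤ 1 :=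
  discrepancy_le_of_arcs P zero_le_one fun a b hab => by
    have : P.real ((fun x : ℝ => (x : AddCircle (1 : ℝ))) '' Set.Icc a b) ≤ 1 := measureReal_le_one
    linarith

lemma isProbabilityMeasure_circleQ {d : ℕ} (hd : 1 ≤ d) (α : Fin d → ℝ) :
    IsProbabilityMeasure (circleQ α) := by
  refine ⟨?_⟩
  simp only [circleQ, Measure.smul_apply, Measure.coe_finsetSum, Finset.sum_apply,
    Measure.coe_add, Pi.add_apply, measure_univ, Finset.sum_const, Finset.card_univ,
    Fintype.card_fin, smul_eq_mul, nsmul_eq_mul]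
  rw [one_add_one_eq_two, mul_comm (d : ℝ≥0∞)]
  refine ENNReal.inv_mul_cancel ?_ ?_
  · simp; omega
  · exact ENNReal.mul_ne_top (by simp) (by simp)

lemma isProbabilityMeasure_convPow (μ : Measure (AddCircle (1 : ℝ))) [IsProbabilityMeasure μ] :
    ∀ k, IsProbabilityMeasure (convPow μ k)
  | 0 => by unfold convPow; infer_instance
  | k + 1 => by
    have := isProbabilityMeasure_convPow μ k
    unfold convPow
    infer_instance

lemma integrable_fourier (μ : Measure (AddCircle (1 : ℝ))) [IsFiniteMeasure μ] (n : ℤ) :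
    Integrable (fun x => (fourier n x : ℂ)) μ :=
  Continuous.integrable_of_hasCompactSupport (by fun_prop) (HasCompactSupport.of_compactSpace _)

lemma integral_fourier_conv (μ ν : Measure (AddCircle (1 : ℝ))) [IsFiniteMeasure μ]
    [IsFiniteMeasure ν] (n : ℤ) :
    ∫ x, (fourier n x : ℂ) ∂(μ.conv ν) =
      (∫ x, (fourier n x : ℂ) ∂μ) * ∫ x, (fourier n x : ℂ) ∂ν := by
  rw [Measure.conv, integral_map (by fun_prop) (by fun_prop), ← integral_prod_mul]
  congr 1
  funext x
  simp [fourier_apply, smul_add, AddCircle.toCircle_add]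

lemma integral_fourier_convPow (μ : Measure (AddCircle (1 : ℝ))) [IsProbabilityMeasure μ]
    (n : ℤ) (k : ℕ) :
    ∫ x, (fourier n x : ℂ) ∂(convPow μ k) = (∫ x, (fourier n x : ℂ) ∂μ) ^ k := by
  induction k with
  | zero => simp [convPow]
  | succ k ih =>
    have := isProbabilityMeasure_convPow μ k
    rw [convPow, integral_fourier_conv, ih, pow_succ]

lemma integral_fourier_circleQ {d : ℕ} (α : Fin d → ℝ) (n : ℤ) :
    ∫ x, (fourier n x : ℂ) ∂(circleQ α) =
      (((d : ℝ)⁻¹ * ∑ j, cos (2 * π * n * α j) : ℝ) : ℂ) := by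
  rw [circleQ, integral_smul_measure, integral_finsetSum_measure fun i _ => integrable_fourier _ n]
  have h : ∀ j, ∫ x, (fourier n x : ℂ) ∂(Measure.dirac ((α j : ℝ) : AddCircle (1 : ℝ)) +
      Measure.dirac (((-(α j) : ℝ)) : AddCircle (1 : ℝ))) =
      ((2 * cos (2 * π * n * α j) : ℝ) : ℂ) := by
    intro j
    rw [integral_add_measure (integrable_fourier _ n) (integrable_fourier _ n), integral_dirac,
      integral_dirac, fourier_coe_apply, fourier_coe_apply]
    push_cast
    rw [Complex.cos]
    rw [mul_div_cancel₀ _ (two_ne_zero)]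
    congr 2 <;> ring
  simp_rw [h]
  rw [← Complex.ofReal_sum, ← Finset.mul_sum]
  simp
  ring

/-- Coordinatewise signed distance of `2 n α` to the nearest integer vector. -/
def signedRem {d : ℕ} (α : Fin d → ℝ) (n : ℕ) (i : Fin d) : ℝ :=
  2 * n * α i - round (2 * n * α i)

lemma abs_cos_le_signedRem {d : ℕ} (α : Fin d → ℝ) (n : ℕ) (i : Fin d) :
    |cos (2 * π * n * α i)| ≤ 1 - 4 * signedRem α n i ^ 2 := by
  have hy : |signedRem α n i| ≤ 1 / 2 := abs_sub_round _
  have h1 : |cos (2 * π * n * α i)| = |cos (π * signedRem α n i)| := by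
    have : 2 * π * n * α i = π * signedRem α n i + (round (2 * n * α i) : ℤ) * π := by
      rw [signedRem]; ring
    rw [this, cos_add_int_mul_pi, abs_mul]
    simp
  rw [h1]
  set y := signedRem α n i
  obtain ⟨hy1, hy2⟩ := abs_le.mp hy
  have hpos : 0 ≤ cos (π * y) := by
    apply cos_nonneg_of_neg_pi_div_two_le_of_le <;> nlinarith [pi_pos]
  rw [abs_of_nonneg hpos]
  have h2 : cos (π * y) = 1 - 2 * sin (π * |y| / 2) ^ 2 := by
    rw [← cos_abs, abs_mul, abs_of_pos pi_pos]
    have := cos_sq' (π * |y| / 2)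
    have h3 := cos_two_mul (π * |y| / 2)
    rw [show 2 * (π * |y| / 2) = π * |y| by ring] at h3
    linarith
  have h4 : √2 * |y| ≤ sin (π * |y| / 2) := by
    have hc : (1 - 2 * |y|) • sin 0 + (2 * |y|) • sin (π / 4) ≤
        sin ((1 - 2 * |y|) • 0 + (2 * |y|) • (π / 4)) :=
      strictConcaveOn_sin_Icc.concaveOn.2 ⟨le_rfl, pi_pos.le⟩
        ⟨by positivity, by linarith [pi_pos]⟩ (by linarith) (by positivity) (by ring)
    simp only [smul_eq_mul, sin_zero, mul_zero, zero_add, sin_pi_div_four] at hc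
    calc _ = 2 * |y| * (√2 / 2) := by ring
      _ ≤ _ := hc
      _ = _ := by ring_nf
  have h5 : (√2 * |y|) ^ 2 ≤ sin (π * |y| / 2) ^ 2 := by gcongr
  rw [mul_pow, sq_abs, Real.sq_sqrt zero_le_two] at h5
  rw [h2]
  linarith

lemma norm_integral_fourier_convPow_le {d : ℕ} (hd : 1 ≤ d) (α : Fin d → ℝ) (n k : ℕ) :
    ‖∫ x, (fourier (n : ℤ) x : ℂ) ∂(convPow (circleQ α) k)‖ ≤
      exp (-(4 * k / d * ∑ i, signedRem α n i ^ 2)) := by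
  have := isProbabilityMeasure_circleQ hd α
  have hd' : (0 : ℝ) < d := by exact_mod_cast hd
  rw [integral_fourier_convPow, norm_pow, integral_fourier_circleQ, Complex.norm_real]
  have h : ‖(d : ℝ)⁻¹ * ∑ j, cos (2 * π * (n : ℤ) * α j)‖ ≤
      exp (-(4 / d * ∑ i, signedRem α n i ^ 2)) := by
    rw [norm_mul, Real.norm_eq_abs, Real.norm_eq_abs, abs_of_pos (by positivity)]
    calc _ ≤ (d : ℝ)⁻¹ * ∑ j, (1 - 4 * signedRem α n j ^ 2) := by
          gcongr
          refine (Finset.abs_sum_le_sum_abs _ _).trans (Finset.sum_le_sum fun i _ => ?_)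
          exact abs_cos_le_signedRem α n i
      _ = -(4 / d * ∑ i, signedRem α n i ^ 2) + 1 := by
          rw [Finset.sum_sub_distrib, ← Finset.mul_sum]
          simp
          field_simp
          ring
      _ ≤ _ := add_one_le_exp _
  calc _ ≤ exp (-(4 / d * ∑ i, signedRem α n i ^ 2)) ^ k := by gcongr
    _ = _ := by
      rw [← exp_nat_mul]
      congr 1
      ring

lemma sum_exp_neg_mul_sq_le {b : ℝ} (hb : 0 < b) (M : ℕ) :
    ∑ j ∈ Finset.range M, exp (-b * (j : ℝ) ^ 2) ≤ 1 + √(π / b) / 2 := by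
  have hanti : ∀ N : ℕ, AntitoneOn (fun x : ℝ => exp (-b * x ^ 2)) (Set.Icc 0 (0 + (N : ℝ))) := by
    intro N x hx y hy hxy
    have : x ^ 2 ≤ y ^ 2 := pow_le_pow_left₀ hx.1 hxy 2
    exact exp_le_exp.mpr (by nlinarith)
  cases M with
  | zero => simp; positivity
  | succ N =>
    rw [Finset.sum_range_succ']
    have h1 := (hanti N).sum_le_integral
    have h2 : ∫ x in (0 : ℝ)..(0 + N), exp (-b * x ^ 2) ≤ ∫ x in Set.Ioi (0 : ℝ), exp (-b * x ^ 2) := by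
      rw [intervalIntegral.integral_of_le (by positivity)]
      exact setIntegral_mono_set (integrable_exp_neg_mul_sq hb).integrableOn
        (Filter.Eventually.of_forall fun x => (exp_pos _).le)
        (Set.Ioc_subset_Ioi_self.eventuallyLE)
    rw [integral_gaussian_Ioi] at h2
    simp only [zero_add] at h1 h2
    push_cast at h1 ⊢
    norm_num
    norm_num at h1 h2
    linarith

lemma abs_sub_lt_one_of_floor_eq {x y : ℝ} (hs : 0 ≤ x ↔ 0 ≤ y)
    (hf : ⌊|x|⌋₊ = ⌊|y|⌋₊) : |x - y| < 1 := by
  have h1 := Nat.floor_le (abs_nonneg x)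
  have h2 := Nat.lt_floor_add_one |x|
  have h3 := Nat.floor_le (abs_nonneg y)
  have h4 := Nat.lt_floor_add_one |y|
  rw [hf] at h1 h2
  generalize ((⌊|y|⌋₊ : ℕ) : ℝ) = f at h1 h2 h3 h4
  rw [abs_lt]
  by_cases hx : 0 ≤ x
  · rw [abs_of_nonneg hx] at h1 h2
    rw [abs_of_nonneg (hs.mp hx)] at h3 h4
    constructor <;> linarith
  · have hy : ¬ 0 ≤ y := fun h => hx (hs.mpr h)
    rw [abs_of_neg (not_le.mp hx)] at h1 h2
    rw [abs_of_neg (not_le.mp hy)] at h3 h4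
    constructor <;> linarith

/-- Gaussian sums over a separated set of points of `ℝ^d`. -/
lemma sum_exp_le_of_separated {d : ℕ} (hd : 1 ≤ d) (s : Finset ℕ) (y : ℕ → Fin d → ℝ)
    {δ c : ℝ} (hδ : 0 < δ) (hc : 0 < c)
    (hsep : ∀ m ∈ s, ∀ m' ∈ s, m ≠ m' → δ ^ 2 ≤ ∑ i, (y m i - y m' i) ^ 2)
    (hzero : ∀ m ∈ s, δ ^ 2 ≤ ∑ i, y m i ^ 2) :
    ∑ m ∈ s, exp (-(2 * c * ∑ i, y m i ^ 2)) ≤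
      (exp (-(c * δ ^ 2 / d)) * (2 + √(π / (c * δ ^ 2 / d)))) ^ d := by
  have hd' : (0 : ℝ) < d := by exact_mod_cast hd
  set b := c * δ ^ 2 / d with hb
  have hbpos : 0 < b := by positivity
  set σ := δ / √d with hσ
  have hσpos : 0 < σ := by positivity
  have hσ2 : d * σ ^ 2 = δ ^ 2 := by
    rw [hσ, div_pow, Real.sq_sqrt hd'.le]
    field_simp
  have hcσ : c * σ ^ 2 = b := by
    rw [hb, ← hσ2]; field_simp
  set code : ℕ → Fin d → Bool × ℕ :=
    fun m i => (decide (0 ≤ y m i / σ), ⌊|y m i / σ|⌋₊) with hcode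
  have hinj : Set.InjOn code s := by
    intro m hm m' hm' h
    by_contra hne
    have hlt : ∀ i, (y m i - y m' i) ^ 2 < σ ^ 2 := by
      intro i
      have hi := congrFun h i
      simp only [hcode, Prod.mk.injEq, decide_eq_decide] at hi
      have := abs_sub_lt_one_of_floor_eq hi.1 hi.2
      rw [← sub_div, abs_div, abs_of_pos hσpos, div_lt_one hσpos] at this
      rw [← sq_abs]
      gcongr
    have h1 : ∑ i, (y m i - y m' i) ^ 2 < ∑ _i : Fin d, σ ^ 2 :=
      Finset.sum_lt_sum_of_nonempty ⟨⟨0, hd⟩, Finset.mem_univ _⟩ fun i _ => hlt i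
    simp only [Finset.sum_const, Finset.card_univ, Fintype.card_fin, nsmul_eq_mul, hσ2] at h1
    exact absurd (hsep m hm m' hm' hne) (not_le.mpr h1)
  set M := ∑ m ∈ s, ∑ i, ⌊|y m i / σ|⌋₊ + 1 with hM
  have hmem : ∀ m ∈ s, code m ∈ Fintype.piFinset
      fun _ : Fin d => (Finset.univ : Finset Bool) ×ˢ Finset.range M := by
    intro m hm
    rw [Fintype.mem_piFinset]
    intro i
    simp only [hcode, Finset.mem_product, Finset.mem_univ, Finset.mem_range, true_and, hM,
      Nat.lt_succ_iff]
    calc ⌊|y m i / σ|⌋₊ ≤ ∑ i, ⌊|y m i / σ|⌋₊ :=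
          Finset.single_le_sum (f := fun i => ⌊|y m i / σ|⌋₊) (fun _ _ => Nat.zero_le _)
            (Finset.mem_univ i)
      _ ≤ _ := Finset.single_le_sum (f := fun m => ∑ i, ⌊|y m i / σ|⌋₊)
            (fun _ _ => Nat.zero_le _) hm
  set w : Bool × ℕ → ℝ := fun p => exp (-b * (p.2 : ℝ) ^ 2) with hw
  have hterm : ∀ m ∈ s, exp (-(2 * c * ∑ i, y m i ^ 2)) ≤ exp (-b) ^ d * ∏ i, w (code m i) := by
    intro m hm
    rw [hw, ← exp_nat_mul, ← exp_sum, ← exp_add]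
    gcongr
    have h1 : b * ∑ i, ((code m i).2 : ℝ) ^ 2 ≤ c * ∑ i, y m i ^ 2 := by
      rw [Finset.mul_sum, Finset.mul_sum]
      refine Finset.sum_le_sum fun i _ => ?_
      have hfl : (((code m i).2 : ℕ) : ℝ) ≤ |y m i / σ| := Nat.floor_le (abs_nonneg _)
      have : (((code m i).2 : ℕ) : ℝ) ^ 2 ≤ (y m i / σ) ^ 2 := by
        rw [← sq_abs (y m i / σ)]
        gcongr
      calc _ ≤ b * (y m i / σ) ^ 2 := by gcongr
        _ = _ := by rw [← hcσ]; field_simp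
    have h2 : d * b ≤ c * ∑ i, y m i ^ 2 := by
      calc d * b = c * δ ^ 2 := by rw [hb]; field_simp
        _ ≤ _ := by gcongr; exact hzero m hm
    rw [← Finset.mul_sum]
    linarith
  calc _ ≤ ∑ m ∈ s, exp (-b) ^ d * ∏ i, w (code m i) := Finset.sum_le_sum hterm
    _ = exp (-b) ^ d * ∑ x ∈ s.image code, ∏ i, w (x i) := by
      rw [Finset.sum_image hinj, Finset.mul_sum]
    _ ≤ exp (-b) ^ d * ∑ x ∈ Fintype.piFinset
        fun _ : Fin d => (Finset.univ : Finset Bool) ×ˢ Finset.range M, ∏ i, w (x i) := by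
      gcongr
      intro x hx
      obtain ⟨m, hm, rfl⟩ := Finset.mem_image.mp hx
      exact hmem m hm
    _ = exp (-b) ^ d * (2 * ∑ j ∈ Finset.range M, exp (-b * (j : ℝ) ^ 2)) ^ d := by
      rw [Finset.sum_prod_piFinset _ fun _ p => w p]
      simp [hw, Finset.sum_product]
    _ ≤ exp (-b) ^ d * (2 + √(π / b)) ^ d := by
      gcongr
      linarith [sum_exp_neg_mul_sq_le hbpos M]
    _ = _ := by rw [mul_pow]

lemma sqrt_pi_le : √π ≤ 1.8 := by
  rw [Real.sqrt_le_left (by norm_num)]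
  linarith [pi_lt_d2]

lemma gaussian_factor_mul_sq_le {r : ℝ} (hr : 0 < r) :
    exp (-r ^ 2) * (2 + √π / r) * r ^ 2 ≤ 2 := by
  have h1 := Real.quadratic_le_exp_of_nonneg (sq_nonneg r)
  have h2 := sqrt_pi_le
  rw [exp_neg, inv_mul_eq_div, div_mul_eq_mul_div, div_le_iff₀ (exp_pos _)]
  have h3 : (2 + √π / r) * r ^ 2 = 2 * r ^ 2 + √π * r := by field_simp
  rw [h3]
  have h4 : √π * r ≤ 1.8 * r := by gcongr
  nlinarith [sq_nonneg (r ^ 2 - 1 / 2), sq_nonneg (r - 0.8)]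

lemma gaussian_factor_mul_le {r : ℝ} (hr : 0 < r) :
    exp (-r ^ 2) * (2 + √π / r) * r ≤ 2.4 := by
  have h1 := add_one_le_exp (r ^ 2)
  have h2 := sqrt_pi_le
  rw [exp_neg, inv_mul_eq_div, div_mul_eq_mul_div, div_le_iff₀ (exp_pos _)]
  have h3 : (2 + √π / r) * r = 2 * r + √π := by field_simp
  rw [h3]
  nlinarith [sq_nonneg (r - 0.5)]

lemma three_div_pow_le {d : ℕ} (hd : 1 ≤ d) : (3 / (d : ℝ)) ^ d ≤ 4 := by
  rcases lt_or_ge d 3 with h | h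
  · interval_cases d <;> norm_num
  · have h3 : (3 : ℝ) ≤ d := by exact_mod_cast h
    refine (pow_le_one₀ (by positivity) ?_).trans (by norm_num)
    rw [div_le_one (by linarith)]
    exact h3

lemma gaussian_factor_pow_le {d : ℕ} (hd : 1 ≤ d) {p b : ℝ} (hp : 0 < p)
    (hb : b = 2 * d / p ^ 2) :
    (exp (-b) * (2 + √(π / b))) ^ d ≤ (p ^ d) ^ 2 ∧
      (exp (-b) * (2 + √(π / b))) ^ d ≤ 2 * p ^ d := by
  have hd1 : (1 : ℝ) ≤ d := by exact_mod_cast hd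
  have hbpos : 0 < b := by rw [hb]; positivity
  set r := √b with hr
  have hrpos : 0 < r := Real.sqrt_pos.mpr hbpos
  have hr2 : r ^ 2 = b := Real.sq_sqrt hbpos.le
  have hsq : √(π / b) = √π / r := Real.sqrt_div pi_pos.le b
  have h1 := gaussian_factor_mul_sq_le hrpos
  have h2 := gaussian_factor_mul_le hrpos
  rw [hr2] at h1 h2
  rw [hsq]
  set h := exp (-b) * (2 + √π / r) with hh
  have hpos : 0 < h := by positivity
  have hbp : b * p ^ 2 = 2 * d := by rw [hb]; field_simp
  constructor
  · rw [← pow_mul, mul_comm d 2, pow_mul]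
    gcongr
    have : h * (2 * d) ≤ 2 * p ^ 2 := by rw [← hbp]; nlinarith [sq_nonneg p]
    nlinarith
  · have h3 : h ^ 2 ≤ 3 / d * p ^ 2 := by
      have h4 : h ^ 2 * b ≤ 6 := by
        rw [← hr2, ← mul_pow]
        calc _ ≤ (2.4 : ℝ) ^ 2 := by gcongr
          _ ≤ 6 := by norm_num
      have h5 : h ^ 2 * (2 * d) ≤ 6 * p ^ 2 := by rw [← hbp]; nlinarith [sq_nonneg p]
      rw [div_mul_eq_mul_div, le_div_iff₀ (by positivity)]
      linarith
    refine le_of_sq_le_sq ?_ (by positivity)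
    calc (h ^ d) ^ 2 = (h ^ 2) ^ d := by rw [← pow_mul, ← pow_mul, mul_comm]
      _ ≤ (3 / d * p ^ 2) ^ d := by gcongr
      _ = (3 / (d : ℝ)) ^ d * (p ^ d) ^ 2 := by ring
      _ ≤ 4 * (p ^ d) ^ 2 := by gcongr; exact three_div_pow_le hd
      _ = _ := by ring

lemma latticeDist_sq_le {d : ℕ} (x : Fin d → ℝ) (v : Fin d → ℤ) {δ : ℝ} (hδ : 0 ≤ δ)
    (h : δ ≤ latticeDist x) : δ ^ 2 ≤ ∑ i, (x i - v i) ^ 2 := by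
  have h1 : latticeDist x ≤ √(∑ i, (x i - v i) ^ 2) :=
    ciInf_le ⟨0, by rintro _ ⟨w, rfl⟩; exact Real.sqrt_nonneg _⟩ v
  exact (Real.le_sqrt hδ (Finset.sum_nonneg fun i _ => sq_nonneg _)).mp (h.trans h1)

/-- Gaussian sums over multiples of a badly approximable vector. -/
lemma sum_exp_signedRem_le {d : ℕ} (hd : 1 ≤ d) (α : Fin d → ℝ) {β : ℝ} (hβ : 0 < β)
    (hbad : ∀ N : ℕ, 0 < N →
      β / (N : ℝ) ^ ((1 : ℝ) / d) ≤ latticeDist (fun i => (N : ℝ) * α i))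
    {k : ℕ} (hk : 0 < k) (N : ℕ) :
    ∑ n ∈ Finset.Ioc 0 N, exp (-(4 * k / d * ∑ i, signedRem α n i ^ 2)) ≤
        4 * (N * (d * √d / (β * √k)) ^ d) ^ 2 ∧
      ∑ n ∈ Finset.Ioc 0 N, exp (-(4 * k / d * ∑ i, signedRem α n i ^ 2)) ≤
        4 * (N * (d * √d / (β * √k)) ^ d) := by
  rcases Nat.eq_zero_or_pos N with rfl | hN
  · simp
  have hd' : (0 : ℝ) < d := by exact_mod_cast hd
  have hk' : (0 : ℝ) < k := by exact_mod_cast hk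
  have hN' : (0 : ℝ) < N := by exact_mod_cast hN
  set ρ := (2 * (N : ℝ)) ^ ((1 : ℝ) / d) with hρ
  have hρpos : 0 < ρ := by positivity
  have hρd : ρ ^ d = 2 * N := by
    rw [hρ, one_div, Real.rpow_inv_natCast_pow (by positivity) (by omega)]
  set q := d * √d / (β * √k) with hq
  have hqpos : 0 < q := by positivity
  have hq2 : q ^ 2 = d ^ 3 / (β ^ 2 * k) := by
    rw [hq, div_pow, mul_pow, mul_pow, Real.sq_sqrt hd'.le, Real.sq_sqrt hk'.le]
    ring
  have hdist : ∀ n : ℕ, 0 < n → n ≤ N → β / ρ ≤ latticeDist (fun i => ((2 * n : ℕ) : ℝ) * α i) := by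
    intro n hn hnN
    refine le_trans ?_ (hbad (2 * n) (by omega))
    have : (n : ℝ) ≤ N := by exact_mod_cast hnN
    have hn' : (0 : ℝ) < n := by exact_mod_cast hn
    rw [hρ]
    push_cast
    gcongr
  have hδ : 0 < β / ρ := by positivity
  have hsep : ∀ m m' : ℕ, m < m' → m' ≤ N →
      (β / ρ) ^ 2 ≤ ∑ i, (signedRem α m' i - signedRem α m i) ^ 2 := by
    intro m m' h h'
    have := latticeDist_sq_le _ (fun i => round (2 * m' * α i) - round (2 * m * α i)) hδ.le
      (hdist (m' - m) (by omega) (by omega))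
    refine this.trans (le_of_eq (Finset.sum_congr rfl fun i _ => ?_))
    rw [signedRem, signedRem]
    push_cast [Nat.cast_sub h.le]
    ring
  have key := sum_exp_le_of_separated hd (Finset.Ioc 0 N) (signedRem α) (δ := β / ρ)
    (c := 2 * k / d) hδ (by positivity)
    (by
      intro m hm m' hm' hne
      rw [Finset.mem_Ioc] at hm hm'
      rcases lt_or_gt_of_ne hne with h | h
      · refine (hsep m m' h hm'.2).trans (le_of_eq (Finset.sum_congr rfl fun i _ => by ring))
      · exact hsep m' m h hm.2)
    (by
      intro m hm
      rw [Finset.mem_Ioc] at hm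
      have := latticeDist_sq_le _ (fun i => round (2 * m * α i)) hδ.le (hdist m hm.1 hm.2)
      refine this.trans (le_of_eq (Finset.sum_congr rfl fun i _ => ?_))
      rw [signedRem]
      push_cast
      ring)
  have hb : 2 * k / d * (β / ρ) ^ 2 / d = 2 * d / (q * ρ) ^ 2 := by
    rw [mul_pow, hq2]
    field_simp
  obtain ⟨h1, h2⟩ := gaussian_factor_pow_le hd (p := q * ρ) (by positivity) hb
  have hp : (q * ρ) ^ d = 2 * (N * q ^ d) := by rw [mul_pow, hρd]; ring
  rw [hp] at h1 h2
  have e : ∀ n : ℕ, 2 * (2 * (k : ℝ) / d) * ∑ i, signedRem α n i ^ 2 =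
      4 * k / d * ∑ i, signedRem α n i ^ 2 := fun n => by ring
  simp_rw [e] at key
  constructor
  · refine (key.trans h1).trans (le_of_eq (by ring))
  · refine (key.trans h2).trans (le_of_eq (by ring))

lemma smoothWeight_sub_succ_le {ε : ℝ} (hε : 0 < ε) {n : ℕ} (hn : 0 < n) :
    smoothWeight ε n - smoothWeight ε (n + 1) ≤ 2 / (3 * (n : ℝ) ^ 2) ∧
      smoothWeight ε n - smoothWeight ε (n + 1) ≤ 2 / (9 * ε * (n : ℝ) ^ 3) := by
  have hx : (0 : ℝ) < n := by exact_mod_cast hn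
  unfold smoothWeight
  push_cast
  generalize (n : ℝ) = x at hx
  have h1 : min (1 / (3 * x)) (1 / (9 * ε * x ^ 2)) ≤ 1 / (3 * x) := min_le_left _ _
  have h2 : min (1 / (3 * x)) (1 / (9 * ε * x ^ 2)) ≤ 1 / (9 * ε * x ^ 2) := min_le_right _ _
  have hA : 1 / (3 * x) - 1 / (3 * (x + 1)) = 1 / (3 * x * (x + 1)) := by field_simp; ring
  have hB : 1 / (9 * ε * x ^ 2) - 1 / (9 * ε * (x + 1) ^ 2) =
      (2 * x + 1) / (9 * ε * x ^ 2 * (x + 1) ^ 2) := by field_simp; ring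
  rcases le_total (1 / (3 * (x + 1))) (1 / (9 * ε * (x + 1) ^ 2)) with h | h
  · have hc : 9 * ε * (x + 1) ≤ 3 := by
      rw [div_le_div_iff₀ (by positivity) (by positivity)] at h
      nlinarith
    rw [min_eq_left h]
    have h3 := (sub_le_sub_right h1 (1 / (3 * (x + 1)))).trans_eq hA
    constructor
    · refine h3.trans ?_
      rw [div_le_div_iff₀ (by positivity) (by positivity)]
      nlinarith
    · refine h3.trans ?_
      rw [div_le_div_iff₀ (by positivity) (by positivity)]
      have : 9 * ε * x ^ 3 ≤ 3 * x ^ 2 := by nlinarith [mul_pos hε (pow_pos hx 2), pow_pos hx 2]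
      nlinarith
  · have hc : 3 ≤ 9 * ε * (x + 1) := by
      rw [div_le_div_iff₀ (by positivity) (by positivity)] at h
      nlinarith
    rw [min_eq_right h]
    have h3 := (sub_le_sub_right h2 (1 / (9 * ε * (x + 1) ^ 2))).trans_eq hB
    constructor
    · refine h3.trans ?_
      calc (2 * x + 1) / (9 * ε * x ^ 2 * (x + 1) ^ 2)
          = (2 * x + 1) / ((9 * ε * (x + 1)) * (x ^ 2 * (x + 1))) := by ring
        _ ≤ (2 * x + 1) / (3 * (x ^ 2 * (x + 1))) := by gcongr
        _ ≤ 2 / (3 * x ^ 2) := by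
          rw [div_le_div_iff₀ (by positivity) (by positivity)]
          nlinarith [pow_pos hx 2]
    · refine h3.trans ?_
      have e1 : (2 * x + 1) / (9 * ε * x ^ 2 * (x + 1) ^ 2) =
          1 / (9 * ε) * ((2 * x + 1) / (x ^ 2 * (x + 1) ^ 2)) := by field_simp
      have e2 : 2 / (9 * ε * x ^ 3) = 1 / (9 * ε) * (2 / x ^ 3) := by field_simp
      rw [e1, e2]
      refine mul_le_mul_of_nonneg_left ?_ (by positivity)
      rw [div_le_div_iff₀ (by positivity) (by positivity)]
      nlinarith [pow_pos hx 2, pow_pos hx 3]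

lemma sum_Ioc_mul_eq_by_parts (w g : ℕ → ℝ) (N : ℕ) :
    ∑ n ∈ Finset.Ioc 0 N, w n * g n =
      ∑ n ∈ Finset.Ioc 0 N, (w n - w (n + 1)) * ∑ m ∈ Finset.Ioc 0 n, g m +
        w (N + 1) * ∑ m ∈ Finset.Ioc 0 N, g m := by
  induction N with
  | zero => simp
  | succ N ih =>
    simp only [Finset.sum_Ioc_succ_top (Nat.zero_le N), ih]
    ring

/-- Weighted sums of a sequence whose partial sums grow at most like `min (N T) ((N T) ^ 2)`. -/
lemma sum_smoothWeight_mul_le {T : ℝ} (hT : 0 < T) (hT1 : T ≤ 1) {g : ℕ → ℝ} (hg : ∀ n, 0 ≤ g n)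
    (hquad : ∀ N : ℕ, ∑ n ∈ Finset.Ioc 0 N, g n ≤ 4 * (N * T) ^ 2)
    (hlin : ∀ N : ℕ, ∑ n ∈ Finset.Ioc 0 N, g n ≤ 4 * (N * T)) (M : ℕ) :
    ∑ n ∈ Finset.range M, smoothWeight T n * g n ≤ 7 * T := by
  set X := ⌈1 / T⌉₊ with hX
  have hX1 : 1 / T ≤ X := Nat.le_ceil _
  have hX2 : (X : ℝ) ≤ 2 / T := by
    have := (Nat.ceil_lt_add_one (by positivity : (0 : ℝ) ≤ 1 / T)).le
    have h1 : 1 ≤ 1 / T := by rw [le_div_iff₀ hT]; linarith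
    calc (X : ℝ) ≤ 1 / T + 1 := this
      _ ≤ 1 / T + 1 / T := by gcongr
      _ = 2 / T := by ring
  have hXpos : (0 : ℝ) < X := lt_of_lt_of_le (by positivity) hX1
  have hXT : 1 / (X : ℝ) ≤ T := by
    rw [div_le_iff₀ hXpos]
    rw [div_le_iff₀ hT] at hX1
    linarith
  set N := max M X with hN
  have hG : ∀ n, 0 ≤ ∑ m ∈ Finset.Ioc 0 n, g m := fun n => Finset.sum_nonneg fun m _ => hg m
  have hstep : ∑ n ∈ Finset.range M, smoothWeight T n * g n ≤
      ∑ n ∈ Finset.Ioc 0 N, smoothWeight T n * g n := by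
    have h0 : ∑ n ∈ Finset.range M, smoothWeight T n * g n =
        ∑ n ∈ (Finset.range M).erase 0, smoothWeight T n * g n := by
      refine (Finset.sum_erase _ ?_).symm
      simp [smoothWeight]
    rw [h0]
    refine Finset.sum_le_sum_of_subset_of_nonneg ?_ fun n _ _ =>
      mul_nonneg (smoothWeight_nonneg hT n) (hg n)
    intro n hn
    simp only [Finset.mem_erase, Finset.mem_range, Finset.mem_Ioc] at hn ⊢
    omega
  refine hstep.trans ?_
  rw [sum_Ioc_mul_eq_by_parts,
    ← Finset.sum_Ioc_consecutive _ (Nat.zero_le X) (le_max_right M X : X ≤ N)]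
  have hlow : ∑ n ∈ Finset.Ioc 0 X, (smoothWeight T n - smoothWeight T (n + 1)) *
      ∑ m ∈ Finset.Ioc 0 n, g m ≤ 16 / 3 * T := by
    calc _ ≤ ∑ n ∈ Finset.Ioc 0 X, 8 / 3 * T ^ 2 := by
          refine Finset.sum_le_sum fun n hn => ?_
          have hn0 : 0 < n := (Finset.mem_Ioc.mp hn).1
          have hn' : (0 : ℝ) < n := by exact_mod_cast hn0
          calc _ ≤ 2 / (3 * (n : ℝ) ^ 2) * (4 * (n * T) ^ 2) :=
                mul_le_mul (smoothWeight_sub_succ_le hT hn0).1 (hquad n) (hG n) (by positivity)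
            _ = _ := by field_simp; ring
      _ = X * (8 / 3 * T ^ 2) := by simp
      _ ≤ 2 / T * (8 / 3 * T ^ 2) := by gcongr
      _ = _ := by field_simp; ring
  have hhigh : ∑ n ∈ Finset.Ioc X N, (smoothWeight T n - smoothWeight T (n + 1)) *
      ∑ m ∈ Finset.Ioc 0 n, g m ≤ 8 / 9 * T := by
    calc _ ≤ ∑ n ∈ Finset.Ioc X N, 8 / 9 * ((n : ℝ) ^ 2)⁻¹ := by
          refine Finset.sum_le_sum fun n hn => ?_
          have hn0 : 0 < n := (Nat.zero_le _).trans_lt (Finset.mem_Ioc.mp hn).1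
          have hn' : (0 : ℝ) < n := by exact_mod_cast hn0
          calc _ ≤ 2 / (9 * T * (n : ℝ) ^ 3) * (4 * (n * T)) :=
                mul_le_mul (smoothWeight_sub_succ_le hT hn0).2 (hlin n) (hG n) (by positivity)
            _ = _ := by field_simp; ring
      _ ≤ 8 / 9 * T := by
        rw [← Finset.mul_sum]
        gcongr
        have := sum_Ioc_inv_sq_le_sub (α := ℝ) (k := X) (n := N) (by
          intro h; rw [h] at hXpos; simp at hXpos) (le_max_right M X)
        rw [one_div] at hXT
        have h2 : (0 : ℝ) ≤ (N : ℝ)⁻¹ := by positivity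
        linarith
  have hlast : smoothWeight T (N + 1) * ∑ m ∈ Finset.Ioc 0 N, g m ≤ 4 / 9 * T := by
    have hNX : (X : ℝ) ≤ N := by exact_mod_cast le_max_right M X
    have hNpos : (0 : ℝ) < N := hXpos.trans_le hNX
    calc _ ≤ 1 / (9 * T * ((N : ℝ)) ^ 2) * (4 * (N * T)) := by
          refine mul_le_mul ((min_le_right _ _).trans ?_) (hlin N) (hG N) (by positivity)
          push_cast
          gcongr
          linarith
      _ = 4 / 9 * (1 / N) := by field_simp
      _ ≤ 4 / 9 * (1 / X) := by gcongr
      _ ≤ _ := by gcongr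
  linarith

/-- Upper bound on the discrepancy of the walk for badly approximable `α`. -/
theorem discrepancy_upper_bound_badly_approximable
    {d : ℕ} (hd : 1 ≤ d) (α : Fin d → ℝ) (β : ℝ) (hβ : 0 < β)
    (hbad : ∀ N : ℕ, 0 < N →
      β / (N : ℝ) ^ ((1 : ℝ) / d) ≤ latticeDist (fun i => (N : ℝ) * α i))
    (k : ℕ) (hk : 0 < k) :
    discrepancy (convPow (circleQ α) k) ≤
      19.857 * ((d : ℝ) * Real.sqrt d / β) ^ d * (k : ℝ) ^ (-(d : ℝ) / 2) := by
  have hd' : (0 : ℝ) < d := by exact_mod_cast hd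
  have hk' : (0 : ℝ) < k := by exact_mod_cast hk
  have := isProbabilityMeasure_circleQ hd α
  have := isProbabilityMeasure_convPow (circleQ α) k
  set T := (d * √d / (β * √k)) ^ d with hTdef
  have hT : 0 < T := by positivity
  have hrhs : 19.857 * ((d : ℝ) * Real.sqrt d / β) ^ d * (k : ℝ) ^ (-(d : ℝ) / 2) =
      19.857 * T := by
    have hkpow : (k : ℝ) ^ (-(d : ℝ) / 2) = ((√k) ^ d)⁻¹ := by
      rw [Real.sqrt_eq_rpow, ← Real.rpow_natCast, ← Real.rpow_mul hk'.le,
        ← Real.rpow_neg hk'.le]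
      congr 1
      ring
    rw [hkpow, hTdef, ← div_div, div_pow _ (√(k : ℝ)), div_eq_mul_inv _ (√(k : ℝ) ^ d), mul_assoc]
  rw [hrhs]
  rcases le_total 1 T with hT1 | hT1
  · linarith [discrepancy_le_one (convPow (circleQ α) k)]
  have hS : ∀ M : ℕ, ∑ n ∈ Finset.range M, smoothWeight T n *
      ‖∫ x, (fourier (n : ℤ) x : ℂ) ∂(convPow (circleQ α) k)‖ ≤ 7 * T := by
    intro M
    refine le_trans (Finset.sum_le_sum fun n _ => mul_le_mul_of_nonneg_left
      (norm_integral_fourier_convPow_le hd α n k) (smoothWeight_nonneg hT n)) ?_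
    exact sum_smoothWeight_mul_le hT hT1 (fun n => (exp_pos _).le)
      (fun N => (sum_exp_signedRem_le hd α hβ hbad hk N).1)
      (fun N => (sum_exp_signedRem_le hd α hβ hbad hk N).2) M
  refine (discrepancy_le_of_arcs _ (C := 16 * T) (by positivity) fun a b hab => ?_).trans
    (by linarith)
  linarith [measureReal_arc_le (convPow (circleQ α) k) hT hab hS]

end
end

section
/- Let d ≥ 1, let ᾱ = (α_1,...,α_d) ∈ ℝ^d, and let B > 0 be a constant such that for every real q ≥ 1 there exists a positive integer N ≤ q^d with ⟨Nᾱ⟩ < B/q. Let k be a positive integer and set q = (25 B² k / d)^{1/2} = 5B√(k/d); assume q ≥ 1. Then there exists a positive integer m ≤ q^d such that Q̂(m)^k ≥ 1 − 2π²/25, where Q̂(m) = (1/d)Σ_{l=1}^d cos(2π m α_l) is the (real) m-th Fourier coefficient of Q. -/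
open MeasureTheory Real
open scoped ENNReal

noncomputable section

/-- Quadratic lower bound for the cosine in terms of the distance to an integer. -/
theorem cos_two_pi_mul_ge (x : ℝ) (n : ℤ) :
    1 - 2 * π ^ 2 * (x - n) ^ 2 ≤ Real.cos (2 * π * x) := by
  have hcos : Real.cos (2 * π * x) = Real.cos (2 * π * (x - n)) := by
    rw [mul_sub, mul_comm (2 * π) (n : ℝ), Real.cos_sub_int_mul_two_pi]
  have hle := Real.one_sub_sq_div_two_le_cos (x := 2 * π * (x - n))
  rw [hcos]
  linear_combination hle

/-- There is a frequency `m ≤ q^d` (with `q = 5B√(k/d)`) whose `k`-th Fourier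
coefficient power stays bounded below by `1 - 2π²/25`. -/
theorem exists_large_fourierCoeff_pow
    {d : ℕ} (hd : 1 ≤ d) (α : Fin d → ℝ) (B : ℝ) (hB : 0 < B)
    (hdir : ∀ q : ℝ, 1 ≤ q → ∃ N : ℕ, 0 < N ∧ (N : ℝ) ≤ q ^ (d : ℝ) ∧
      latticeDist (fun i => (N : ℝ) * α i) < B / q)
    (k : ℕ) (hk : 0 < k) (q : ℝ) (hq : q = 5 * B * Real.sqrt (k / d)) (hq1 : 1 ≤ q) :
    ∃ m : ℕ, 0 < m ∧ (m : ℝ) ≤ q ^ (d : ℝ) ∧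
      1 - 2 * π ^ 2 / 25 ≤
        ((1 / d : ℝ) * ∑ l : Fin d, Real.cos (2 * π * m * α l)) ^ k := by
  have hd0 : (0 : ℝ) < d := by exact_mod_cast hd
  have hk0 : (0 : ℝ) < k := by exact_mod_cast hk
  have hq0 : 0 < q := by linarith
  obtain ⟨m, hm, hmq, hdist⟩ := hdir q hq1
  refine ⟨m, hm, hmq, ?_⟩
  obtain ⟨v, hv⟩ := exists_lt_of_ciInf_lt hdist
  set S : ℝ := ∑ i, ((m : ℝ) * α i - v i) ^ 2 with hS
  have hqsq : q ^ 2 = 25 * B ^ 2 * (k / d) := by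
    rw [hq, mul_pow, Real.sq_sqrt (by positivity)]
    ring
  have hSlt : S < d / (25 * k) := by
    calc S < (B / q) ^ 2 := (Real.sqrt_lt' (by positivity)).1 hv
      _ = d / (25 * k) := by
        rw [div_pow, hqsq]
        field_simp
  set A : ℝ := (1 / d : ℝ) * ∑ l : Fin d, Real.cos (2 * π * m * α l) with hA
  have hcos_sum : d - 2 * π ^ 2 * S ≤ ∑ l : Fin d, Real.cos (2 * π * m * α l) := by
    calc (d : ℝ) - 2 * π ^ 2 * S
        = ∑ l : Fin d, (1 - 2 * π ^ 2 * ((m : ℝ) * α l - v l) ^ 2) := by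
          simp [hS, Finset.mul_sum]
      _ ≤ _ := Finset.sum_le_sum fun l _ => cos_two_pi_mul_ge (m * α l) (v l)
      _ = _ := by simp only [mul_assoc]
  have hA_lower : 1 - 2 * π ^ 2 / (25 * k) ≤ A := by
    have hmul : d * A = ∑ l : Fin d, Real.cos (2 * π * m * α l) := by
      rw [hA]
      field_simp
    have hπS : 2 * π ^ 2 * S ≤ 2 * π ^ 2 * (d / (25 * k)) := by gcongr
    refine le_of_mul_le_mul_left ?_ hd0
    calc (d : ℝ) * (1 - 2 * π ^ 2 / (25 * k))
        = d - 2 * π ^ 2 * (d / (25 * k)) := by ring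
      _ ≤ d * A := by linarith
  have hA_neg_one : -1 ≤ A := by
    have hsum : -(d : ℝ) ≤ ∑ l : Fin d, Real.cos (2 * π * m * α l) := by
      calc -(d : ℝ) = ∑ _l : Fin d, (-1 : ℝ) := by simp
        _ ≤ _ := Finset.sum_le_sum fun l _ => Real.neg_one_le_cos _
    rw [hA, one_div, ← div_eq_inv_mul, le_div_iff₀ hd0]
    linarith
  calc 1 - 2 * π ^ 2 / 25 = 1 + k * ((1 - 2 * π ^ 2 / (25 * k)) - 1) := by
        field_simp
        ring
    _ ≤ 1 + k * (A - 1) := by gcongr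
    _ ≤ (1 + (A - 1)) ^ k := one_add_mul_le_pow (by linarith) k
    _ = A ^ k := by rw [add_sub_cancel]

end
end

section
/- Let d ≥ 1 and let ᾱ ∈ ℝ^d be badly approximable with constant β > 0. Let j ≥ 1 be an integer and set s = β / (√d · 2^{(j+1)/d}). Then for every a ∈ ℝ^d, the half-open axis-parallel cube [a₁, a₁+s) × ··· × [a_d, a_d+s) contains the point 2mᾱ mod ℤ^d (taken as the representative in [0,1)^d) for at most one integer m with 2^{j−1} ≤ m ≤ 2^j − 1. -/
open MeasureTheory Real
open scoped ENNReal

noncomputable section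

/-- The lattice distance is at most the Euclidean distance to any given lattice point. -/
theorem latticeDist_le {d : ℕ} (x : Fin d → ℝ) (v : Fin d → ℤ) :
    latticeDist x ≤ Real.sqrt (∑ i, (x i - v i) ^ 2) :=
  ciInf_le ⟨0, by rintro _ ⟨w, rfl⟩; exact Real.sqrt_nonneg _⟩ v

/-- If the fractional parts of two points lie in a common half-open cube of side `s`, then their
difference is at lattice distance less than `√d * s`. -/
theorem latticeDist_sub_lt_of_fract_mem_Ico {d : ℕ} (hd : 1 ≤ d) (x y a : Fin d → ℝ) {s : ℝ}
    (hs : 0 < s)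
    (hx : ∀ i, Int.fract (x i) ∈ Set.Ico (a i) (a i + s))
    (hy : ∀ i, Int.fract (y i) ∈ Set.Ico (a i) (a i + s)) :
    latticeDist (fun i => x i - y i) < Real.sqrt d * s := by
  refine (latticeDist_le _ fun i => ⌊x i⌋ - ⌊y i⌋).trans_lt ?_
  have hne : (Finset.univ : Finset (Fin d)).Nonempty := ⟨⟨0, hd⟩, Finset.mem_univ _⟩
  have hsum : ∑ i, (x i - y i - ((⌊x i⌋ - ⌊y i⌋ : ℤ) : ℝ)) ^ 2 < d * s ^ 2 := by
    calc _ < ∑ _i : Fin d, s ^ 2 := by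
          refine Finset.sum_lt_sum_of_nonempty hne fun i _ => ?_
          have hxi := hx i
          have hyi := hy i
          rw [Set.mem_Ico, ← Int.self_sub_floor] at hxi hyi
          push_cast
          exact sq_lt_sq' (by linarith) (by linarith)
      _ = d * s ^ 2 := by simp
  calc _ < Real.sqrt (d * s ^ 2) := Real.sqrt_lt_sqrt (by positivity) hsum
    _ = Real.sqrt d * s := by rw [Real.sqrt_mul (by positivity), Real.sqrt_sq hs.le]

/-- A half-open axis-parallel cube of side `s = β/(√d · 2^{(j+1)/d})` contains the point
`2mα mod ℤ^d` for at most one `m` in the dyadic cohort `[2^{j-1}, 2^j - 1]`. -/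
theorem cube_contains_at_most_one
    {d : ℕ} (hd : 1 ≤ d) (α : Fin d → ℝ) (β : ℝ) (hβ : 0 < β)
    (hbad : ∀ N : ℕ, 0 < N →
      β / (N : ℝ) ^ ((1 : ℝ) / d) ≤ latticeDist (fun i => (N : ℝ) * α i))
    (j : ℕ) (hj : 1 ≤ j) (s : ℝ)
    (hs : s = β / (Real.sqrt d * (2 : ℝ) ^ (((j : ℝ) + 1) / d)))
    (a : Fin d → ℝ) (m₁ m₂ : ℕ)
    (h₁ : 2 ^ (j - 1) ≤ m₁) (h₁' : m₁ ≤ 2 ^ j - 1)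
    (h₂ : 2 ^ (j - 1) ≤ m₂) (h₂' : m₂ ≤ 2 ^ j - 1)
    (hm₁ : ∀ i, Int.fract (2 * (m₁ : ℝ) * α i) ∈ Set.Ico (a i) (a i + s))
    (hm₂ : ∀ i, Int.fract (2 * (m₂ : ℝ) * α i) ∈ Set.Ico (a i) (a i + s)) :
    m₁ = m₂ := by
  have hd0 : (0 : ℝ) < d := by exact_mod_cast hd
  have hs0 : 0 < s := by rw [hs]; positivity
  have key : ∀ m n : ℕ, m < 2 ^ j → n < m →
      (∀ i, Int.fract (2 * (m : ℝ) * α i) ∈ Set.Ico (a i) (a i + s)) →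
      (∀ i, Int.fract (2 * (n : ℝ) * α i) ∈ Set.Ico (a i) (a i + s)) → False := by
    intro m n hm hnm hfm hfn
    have hlt := latticeDist_sub_lt_of_fract_mem_Ico hd _ _ a hs0 hfm hfn
    have hle := hbad (2 * (m - n)) (by omega)
    have hcast : ((2 * (m - n) : ℕ) : ℝ) = 2 * m - 2 * n := by
      push_cast [Nat.cast_sub hnm.le]; ring
    have hfun : (fun i => ((2 * (m - n) : ℕ) : ℝ) * α i) =
        fun i => 2 * (m : ℝ) * α i - 2 * (n : ℝ) * α i := by
      funext i; rw [hcast]; ring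
    rw [hfun] at hle
    have hside : Real.sqrt d * s = β / (2 : ℝ) ^ (((j : ℝ) + 1) / d) := by
      have : Real.sqrt d ≠ 0 := (Real.sqrt_pos.mpr hd0).ne'
      rw [hs]; field_simp
    have hNpos : (0 : ℝ) < ((2 * (m - n) : ℕ) : ℝ) := by
      exact_mod_cast (by omega : 0 < 2 * (m - n))
    have hN : ((2 * (m - n) : ℕ) : ℝ) ≤ (2 : ℝ) ^ ((j : ℝ) + 1) := by
      have : 2 * (m - n) ≤ 2 ^ (j + 1) := by rw [pow_succ]; omega
      calc ((2 * (m - n) : ℕ) : ℝ) ≤ (2 : ℝ) ^ (j + 1) := by exact_mod_cast this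
        _ = (2 : ℝ) ^ ((j : ℝ) + 1) := by rw [← Real.rpow_natCast]; push_cast; rfl
    have hpow : ((2 * (m - n) : ℕ) : ℝ) ^ ((1 : ℝ) / d) ≤ (2 : ℝ) ^ (((j : ℝ) + 1) / d) := by
      calc _ ≤ ((2 : ℝ) ^ ((j : ℝ) + 1)) ^ ((1 : ℝ) / d) :=
            Real.rpow_le_rpow hNpos.le hN (by positivity)
        _ = _ := by rw [← Real.rpow_mul (by norm_num), mul_one_div]
    have hdiv := div_le_div_of_nonneg_left hβ.le (Real.rpow_pos_of_pos hNpos _) hpow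
    linarith
  have hj0 : 0 < 2 ^ j := by positivity
  rcases lt_trichotomy m₁ m₂ with h | h | h
  · exact (key m₂ m₁ (by omega) h hm₂ hm₁).elim
  · exact h
  · exact (key m₁ m₂ (by omega) h hm₁ hm₂).elim

end
end

section
/- Let d ≥ 1 be an integer and let t ≥ 2^{−2/d} be a real number. Then Σ_{n=1}^{∞} (n+1)^{d−1} · exp(−4n²dt) ≤ (1/(1 − e^{−1})) · 2^{d−1} · exp(−4dt); that is, the series is bounded by its first term times 1/(1 − e^{−1}). -/
open MeasureTheory Real
open scoped ENNReal

noncomputable section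

/-- The `(k+1)`-st term of the series is at most `exp (-k)` times the first one. -/
lemma succ_term_le_first_term_mul (d : ℕ) (hd : 1 ≤ d) (t : ℝ) (ht : 1 / 4 ≤ t) (k : ℕ) :
    ((k : ℝ) + 1 + 1) ^ (d - 1) * Real.exp (-(4 * ((k : ℝ) + 1) ^ 2 * d * t)) ≤
      2 ^ (d - 1) * Real.exp (-(4 * d * t)) * Real.exp (-1) ^ k := by
  have hk : (0 : ℝ) ≤ k := k.cast_nonneg
  have hbase : (k : ℝ) + 1 + 1 ≤ 2 * Real.exp k := by
    linarith [Real.add_one_le_exp (k : ℝ)]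
  have hpow : ((k : ℝ) + 1 + 1) ^ (d - 1) ≤ 2 ^ (d - 1) * Real.exp (((d : ℝ) - 1) * k) := by
    calc ((k : ℝ) + 1 + 1) ^ (d - 1) ≤ (2 * Real.exp k) ^ (d - 1) := by gcongr
      _ = 2 ^ (d - 1) * Real.exp (((d : ℝ) - 1) * k) := by
        rw [mul_pow, ← Real.exp_nat_mul, Nat.cast_sub hd, Nat.cast_one]
  calc ((k : ℝ) + 1 + 1) ^ (d - 1) * Real.exp (-(4 * ((k : ℝ) + 1) ^ 2 * d * t))
      ≤ 2 ^ (d - 1) * Real.exp (((d : ℝ) - 1) * k) *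
          Real.exp (-(4 * ((k : ℝ) + 1) ^ 2 * d * t)) := by gcongr
    _ = 2 ^ (d - 1) *
          Real.exp (((d : ℝ) - 1) * k + -(4 * ((k : ℝ) + 1) ^ 2 * d * t)) := by
        rw [mul_assoc, ← Real.exp_add]
    _ ≤ 2 ^ (d - 1) * Real.exp (-(4 * d * t) + k * (-1)) := by
        refine mul_le_mul_of_nonneg_left (Real.exp_le_exp.2 ?_) (by positivity)
        have hdt : (d : ℝ) * (1 / 4) ≤ d * t := by gcongr
        have h₁ : (k : ℝ) * (d * (1 / 4)) ≤ k * (d * t) := by gcongr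
        have h₂ : 0 ≤ (k : ℝ) ^ 2 * (d * t) := by positivity
        have h₃ : 0 ≤ (k : ℝ) * d := by positivity
        linarith
    _ = 2 ^ (d - 1) * Real.exp (-(4 * d * t)) * Real.exp (-1) ^ k := by
        rw [Real.exp_add, Real.exp_nat_mul, ← mul_assoc]

/-- The threshold `2 ^ (-2 / d)` is at least `1 / 4`. -/
lemma one_quarter_le_two_rpow_neg_two_div (d : ℕ) (hd : 1 ≤ d) :
    (1 / 4 : ℝ) ≤ (2 : ℝ) ^ (-(2 : ℝ) / d) := by
  have hd' : (1 : ℝ) ≤ d := by exact_mod_cast hd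
  calc (1 / 4 : ℝ) = (2 : ℝ) ^ (-2 : ℝ) := by
        rw [Real.rpow_neg (by norm_num), Real.rpow_two]; norm_num
    _ ≤ (2 : ℝ) ^ (-(2 : ℝ) / d) := by
        apply Real.rpow_le_rpow_of_exponent_le (by norm_num)
        rw [le_div_iff₀ (by linarith)]
        linarith

/-- For `t ≥ 2^{-2/d}`, the series `Σ_{n≥1} (n+1)^{d-1} e^{-4n²dt}` is bounded by
its first term times `1/(1 - e⁻¹)`. -/
theorem tsum_le_first_term
    (d : ℕ) (hd : 1 ≤ d) (t : ℝ) (ht : (2 : ℝ) ^ (-(2 : ℝ) / d) ≤ t) :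
    ∑' n : ℕ+, ((n : ℝ) + 1) ^ (d - 1) * Real.exp (-(4 * (n : ℝ) ^ 2 * d * t)) ≤
      (1 / (1 - Real.exp (-1))) * 2 ^ (d - 1) * Real.exp (-(4 * d * t)) := by
  have ht' := (one_quarter_le_two_rpow_neg_two_div d hd).trans ht
  have hgeom : HasSum
      (fun k : ℕ => 2 ^ (d - 1) * Real.exp (-(4 * d * t)) * Real.exp (-1) ^ k)
      (2 ^ (d - 1) * Real.exp (-(4 * d * t)) * (1 - Real.exp (-1))⁻¹) :=
    (hasSum_geometric_of_lt_one (Real.exp_pos _).le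
      (Real.exp_lt_one_iff.2 (by norm_num))).mul_left _
  have hle := succ_term_le_first_term_mul d hd t ht'
  have hsum := Summable.of_nonneg_of_le (fun k => by positivity) hle hgeom.summable
  rw [tsum_pnat_eq_tsum_succ
    (f := fun n : ℕ => ((n : ℝ) + 1) ^ (d - 1) * Real.exp (-(4 * (n : ℝ) ^ 2 * d * t)))]
  simp only [Nat.cast_add, Nat.cast_one]
  refine (hsum.tsum_le_tsum hle hgeom.summable).trans_eq ?_
  rw [hgeom.tsum_eq]
  ring

end
end
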